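/- arXiv:cs/0304026 — 5 statements merged into one kernel-verified Lean document; each statement's English description precedes it below -/
import Mathlib

section
/- Let n be a natural number, let 0 ≤ i < j ≤ n−1, and let 𝓕 be a family of subsets of [n] that is s-wise t-intersecting. Then the (i,j)-shift of 𝓕 is also s-wise t-intersecting. -/
/-- The `(i,j)`-shift of a family `𝓕` of subsets of `[n] = {0,…,n-1}`:
each member `F` with `j ∈ F`, `i ∉ F` and `(F \ {j}) ∪ {i} ∉ 𝓕` is replaced by
`(F \ {j}) ∪ {i}`; all other members are unchanged. -/
def shiftFamily (n : ℕ) (i j : Fin n) (𝓕 : Finset (Finset (Fin n))) :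
    Finset (Finset (Fin n)) :=
  𝓕.image (fun F =>
    if j ∈ F ∧ i ∉ F ∧ insert i (F.erase j) ∉ 𝓕 then insert i (F.erase j) else F)

/-- A family `𝓕` of subsets of `[n]` is `s`-wise `t`-intersecting if any `s` members
(with repetition allowed) have intersection of size at least `t`. -/
def SwiseTIntersecting (n s t : ℕ) (𝓕 : Finset (Finset (Fin n))) : Prop :=
  ∀ G : Fin s → Finset (Fin n), (∀ a, G a ∈ 𝓕) → t ≤ (Finset.univ.inf G).card

/-- A member of the `(i,j)`-shift is either a member of `𝓕` whose own shift, if it has one, also lies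
in `𝓕`, or a new set containing `i` but not `j`, obtained from a member of `𝓕`. -/
lemma mem_shiftFamily_cases {n : ℕ} {i j : Fin n} {𝓕 : Finset (Finset (Fin n))}
    {G : Finset (Fin n)} (hG : G ∈ shiftFamily n i j 𝓕) :
    (G ∈ 𝓕 ∧ (j ∈ G → i ∉ G → insert i (G.erase j) ∈ 𝓕)) ∨
      (G ∉ 𝓕 ∧ i ∈ G ∧ j ∉ G ∧ insert j (G.erase i) ∈ 𝓕) := by
  obtain ⟨F, hF, rfl⟩ := Finset.mem_image.mp hG
  split_ifs with hc
  · obtain ⟨hj, hi, hn⟩ := hc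
    have hne : j ≠ i := fun e => hi (e ▸ hj)
    have hi' : i ∉ F.erase j := fun e => hi (Finset.mem_of_mem_erase e)
    refine Or.inr ⟨hn, Finset.mem_insert_self _ _, by simp [hne], ?_⟩
    rwa [Finset.erase_insert hi', Finset.insert_erase hj]
  · exact Or.inl ⟨hF, fun hj hi => by_contra fun hn => hc ⟨hj, hi, hn⟩⟩

/-- If `𝓕` is `s`-wise `t`-intersecting, then so is its `(i,j)`-shift. -/
theorem shift_preserves_swise_tintersecting (n s t : ℕ) (i j : Fin n) (hij : i < j)
    (𝓕 : Finset (Finset (Fin n))) (h : SwiseTIntersecting n s t 𝓕) :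
    SwiseTIntersecting n s t (shiftFamily n i j 𝓕) := by
  intro G hG
  have hG' := fun a => mem_shiftFamily_cases (hG a)
  have hne : i ≠ j := hij.ne
  by_cases hall : ∀ a, G a ∈ 𝓕
  · exact h G hall
  push Not at hall
  obtain ⟨a₀, ha₀⟩ := hall
  by_cases hi : ∀ a, i ∈ G a
  · let K : Fin s → Finset (Fin n) := fun a =>
      if G a ∈ 𝓕 then G a else insert j ((G a).erase i)
    have hK : ∀ a, K a ∈ 𝓕 := by
      intro a
      have := hG' a
      grind
    have hi_mem : i ∈ Finset.univ.inf G := by simpa [Finset.mem_inf] using hi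
    have hsub : Finset.univ.inf K ⊆ insert j ((Finset.univ.inf G).erase i) := by
      intro x hx
      simp only [Finset.mem_inf, Finset.mem_univ, true_imp_iff, Finset.mem_insert,
        Finset.mem_erase] at hx ⊢
      have := hx a₀
      grind
    calc t ≤ (Finset.univ.inf K).card := h K hK
      _ ≤ (insert j ((Finset.univ.inf G).erase i)).card := Finset.card_le_card hsub
      _ ≤ ((Finset.univ.inf G).erase i).card + 1 := Finset.card_insert_le _ _
      _ = (Finset.univ.inf G).card := Finset.card_erase_add_one hi_mem
  · push Not at hi
    obtain ⟨b, hb⟩ := hi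
    let K : Fin s → Finset (Fin n) := fun a =>
      if G a ∈ 𝓕 then
        if j ∈ G a ∧ i ∉ G a then insert i ((G a).erase j) else G a
      else insert j ((G a).erase i)
    have hK : ∀ a, K a ∈ 𝓕 := by
      intro a
      have := hG' a
      grind
    refine (h K hK).trans (Finset.card_le_card fun x hx => ?_)
    simp only [Finset.mem_inf, Finset.mem_univ, true_imp_iff] at hx ⊢
    have hxi : x ≠ i := by
      have := hx a₀
      grind
    have hxj : x ≠ j := by
      have := hx b
      have := hG' b
      grind
    intro a
    have := hx a
    grind
end

section
/- Let s ≥ 2 and t ≥ 1 be integers and let 𝓕 be a left-shifted s-wise t-intersecting family of subsets of [n]. Then for every F ∈ 𝓕 there exists an integer j ≥ 0 such that |F ∩ [t+sj]| ≥ t + (s−1)j. -/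
/-- A family is left-shifted if it is invariant under all `(i,j)`-shifts with `i < j`. -/
def LeftShifted (n : ℕ) (𝓕 : Finset (Finset (Fin n))) : Prop :=
  ∀ i j : Fin n, i < j → shiftFamily n i j 𝓕 = 𝓕

open Finset in
lemma LeftShifted.insert_erase_mem {n : ℕ} {𝓕 : Finset (Finset (Fin n))}
    (hls : LeftShifted n 𝓕) {F : Finset (Fin n)} (hF : F ∈ 𝓕) {i j : Fin n} (hij : i < j)
    (hj : j ∈ F) (hi : i ∉ F) : insert i (F.erase j) ∈ 𝓕 := by
  by_contra h
  have hmem : insert i (F.erase j) ∈ shiftFamily n i j 𝓕 :=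
    mem_image.2 ⟨F, hF, if_pos ⟨hj, hi, h⟩⟩
  rw [hls i j hij] at hmem
  exact h hmem

open Finset in
/-- A left-shifted family contains, with `F`, every set of the same size all of whose
prefixes contain at least as many elements as those of `F`. -/
lemma LeftShifted.mem_of_prefix_card_le {n : ℕ} {𝓕 : Finset (Finset (Fin n))}
    (hls : LeftShifted n 𝓕) {F G : Finset (Fin n)} (hF : F ∈ 𝓕) (hcard : #F = #G)
    (hle : ∀ k ≤ n, #{x ∈ F | x.val < k} ≤ #{x ∈ G | x.val < k}) : G ∈ 𝓕 := by
  induction hd : #(F \ G) generalizing F with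
  | zero =>
    rw [card_eq_zero, sdiff_eq_empty_iff_subset] at hd
    exact eq_of_subset_of_card_le hd hcard.ge ▸ hF
  | succ d ih =>
    have hne : (F \ G).Nonempty := card_pos.1 (by omega)
    obtain ⟨j, hjmem, hjmin⟩ := exists_min_image (F \ G) id hne
    obtain ⟨hjF, hjG⟩ := mem_sdiff.1 hjmem
    have hbelow : ∀ x ∈ F, x < j → x ∈ G := fun x hx hxj => by
      by_contra hxG
      exact absurd (hjmin x (mem_sdiff.2 ⟨hx, hxG⟩)) (not_le.2 hxj)
    obtain ⟨i, hiG, hiF, hij⟩ : ∃ i ∈ G, i ∉ F ∧ i < j := by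
      by_contra! hcon
      have hss : {x ∈ G | x.val < j.val + 1} ⊂ {x ∈ F | x.val < j.val + 1} := by
        refine (ssubset_iff_of_subset fun x hx => ?_).2 ⟨j, by simp [hjF], by simp [hjG]⟩
        simp only [mem_filter] at hx ⊢
        refine ⟨?_, hx.2⟩
        by_contra hxF
        have h1 : j.val ≤ x.val := hcon x hx.1 hxF
        have h2 : x = j := Fin.ext (by omega)
        exact hjG (h2 ▸ hx.1)
      exact absurd (hle (j.val + 1) j.isLt) (not_le.2 (card_lt_card hss))
    have hi' : i ∉ F.erase j := fun h => hiF (mem_of_mem_erase h)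
    have hcard' : #(insert i (F.erase j)) = #F := by
      rw [card_insert_of_notMem hi', card_erase_add_one hjF]
    refine ih (hls.insert_erase_mem hF hij hjF hiF) (hcard'.trans hcard) (fun k hk => ?_) ?_
    · by_cases hkj : k ≤ j.val
      · refine card_le_card fun x hx => ?_
        simp only [mem_filter, mem_insert, mem_erase] at hx ⊢
        refine ⟨?_, hx.2⟩
        rcases hx.1 with rfl | h
        · exact hiG
        · exact hbelow x h.2 (Fin.lt_def.2 (by omega))
      · have hjk : j.val < k := by omega
        have hik : i.val < k := lt_trans hij hjk
        refine le_trans (le_of_eq ?_) (hle k hk)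
        rw [filter_insert, if_pos hik, filter_erase,
          card_insert_of_notMem (fun h => hiF (mem_filter.1 (mem_of_mem_erase h)).1),
          card_erase_add_one (mem_filter.2 ⟨hjF, hjk⟩)]
    · have hsd : insert i (F.erase j) \ G = (F \ G).erase j := by
        rw [insert_sdiff_of_mem _ hiG, erase_sdiff_comm]
      rw [hsd, card_erase_of_mem hjmem, hd, Nat.add_sub_cancel]

open Finset in
lemma card_prefix_add_card_compl_prefix {n : ℕ} (F : Finset (Fin n)) {k : ℕ} (hk : k ≤ n) :
    #{x ∈ F | x.val < k} + #{x ∈ Fᶜ | x.val < k} = k := by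
  rw [← card_union_of_disjoint (disjoint_filter_filter disjoint_compl_right), ← filter_union,
    union_compl, Fin.card_filter_val_lt, min_eq_right hk]

open Finset in
lemma card_le_card_prefix_add {n : ℕ} (A : Finset (Fin n)) {k : ℕ} (hk : k ≤ n) :
    #A ≤ #{x ∈ A | x.val < k} + (n - k) := by
  have h1 := card_filter_add_card_filter_not (s := A) (fun x : Fin n => x.val < k)
  have h2 := card_filter_add_card_filter_not (s := univ) (fun x : Fin n => x.val < k)
  have h3 : #{x ∈ A | ¬ x.val < k} ≤ #{x : Fin n | ¬ x.val < k} :=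
    card_le_card (filter_subset_filter _ (subset_univ A))
  rw [Fin.card_filter_val_lt, min_eq_right hk, card_univ, Fintype.card_fin] at h2
  omega

open Finset in
/-- If `d : Fin m → Fin n` is injective, where `m` is the number of elements missing from
`F ∈ 𝓕`, and more than `i` elements of every prefix of `[n]` containing `d i` are missing
from `F`, then the complement of the range of `d` belongs to `𝓕`. -/
lemma LeftShifted.compl_image_mem {n : ℕ} {𝓕 : Finset (Finset (Fin n))}
    (hls : LeftShifted n 𝓕) {F : Finset (Fin n)} (hF : F ∈ 𝓕) {d : Fin #Fᶜ → Fin n}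
    (hd : Function.Injective d)
    (hlt : ∀ i, ∀ k ≤ n, (d i).val < k → i.val < #{x ∈ Fᶜ | x.val < k}) :
    (univ.image d)ᶜ ∈ 𝓕 := by
  refine hls.mem_of_prefix_card_le hF ?_ fun k hk => ?_
  · have h1 := card_add_card_compl F
    have h2 := card_add_card_compl (univ.image d)
    rw [card_image_of_injective _ hd, card_univ, Fintype.card_fin] at h2
    omega
  · have h1 := card_prefix_add_card_compl_prefix F hk
    have h2 := card_prefix_add_card_compl_prefix (univ.image d) hk
    have h3 : #{x ∈ univ.image d | x.val < k} ≤ #{x ∈ Fᶜ | x.val < k} := by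
      rw [filter_image]
      refine card_image_le.trans ?_
      rw [← card_range #{x ∈ Fᶜ | x.val < k}]
      refine card_le_card_of_injOn Fin.val (fun i hi => ?_) Fin.val_injective.injOn
      exact mem_coe.2 (mem_range.2 (hlt i k hk (mem_filter.1 hi).2))
    omega

/-- In a left-shifted `s`-wise `t`-intersecting family, every member `F` satisfies
`|F ∩ [t + s j]| ≥ t + (s-1) j` for some `j ≥ 0`. -/
theorem left_shifted_prefix_bound (n s t : ℕ) (hs : 2 ≤ s) (ht : 1 ≤ t)
    (𝓕 : Finset (Finset (Fin n)))
    (hls : LeftShifted n 𝓕) (hint : SwiseTIntersecting n s t 𝓕) :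
    ∀ F ∈ 𝓕, ∃ j : ℕ,
      t + (s - 1) * j ≤ (F.filter (fun x => x.val < t + s * j)).card := by
  intro F hF
  by_contra! hcon
  set m := (Fᶜ).card with hm
  have hmn : m ≤ n := by simpa using Finset.card_le_univ Fᶜ
  have hmiss : ∀ j, t + s * j ≤ n →
      j < (Fᶜ.filter (fun x => x.val < t + s * j)).card := fun j hj => by
    have h1 := card_prefix_add_card_compl_prefix F hj
    have h2 := hcon j
    obtain ⟨r, rfl⟩ : ∃ r, s = r + 1 := ⟨s - 1, by omega⟩
    rw [Nat.add_sub_cancel] at h2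
    have h3 : (r + 1) * j = r * j + j := by ring
    omega
  have hn : n < t + s * m := by
    by_contra! h
    exact absurd (hmiss m h) (not_lt.2 (Finset.card_le_card (Finset.filter_subset _ _)))
  let d : Fin s → Fin m → Fin n := fun a j =>
    ⟨min (t - 1 + s * j + a) (n - m + j), by have := j.isLt; omega⟩
  have hdinj : ∀ a, StrictMono (d a) := fun a i j hij => by
    have h1 : i.val < j.val := hij
    have h2 : s * i.val < s * j.val := Nat.mul_lt_mul_of_pos_left h1 (by omega)
    simp only [d, Fin.lt_def]
    omega
  have hmem : ∀ a, (Finset.univ.image (d a))ᶜ ∈ 𝓕 := fun a => by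
    refine hls.compl_image_mem hF (hdinj a).injective fun j k hk hjk => ?_
    have hkm := card_le_card_prefix_add Fᶜ hk
    have hj := j.isLt
    simp only [d] at hjk
    by_cases hc : n - m + j.val < k
    · omega
    · have hle : t + s * j.val ≤ k := by omega
      refine (hmiss j (hle.trans hk)).trans_le (Finset.card_le_card ?_)
      exact Finset.monotone_filter_right _ fun x _ hx => lt_of_lt_of_le hx hle
  have hinter := hint (fun a => (Finset.univ.image (d a))ᶜ) hmem
  have hsub : Finset.univ.inf (fun a => (Finset.univ.image (d a))ᶜ) ⊆
      Finset.univ.filter (fun x : Fin n => x.val < t - 1) := fun x hx => by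
    rw [Finset.mem_inf] at hx
    by_contra hxt
    have hxt : t - 1 ≤ x.val := by simpa using hxt
    have hxn := x.isLt
    obtain ⟨q, a, hqa⟩ : ∃ (q : ℕ) (a : Fin s), s * q + a.val = x.val - (t - 1) :=
      ⟨_, ⟨_, Nat.mod_lt _ (by omega)⟩, Nat.div_add_mod _ s⟩
    have hqm : q < m := by
      refine Nat.lt_of_mul_lt_mul_left (a := s) ?_
      omega
    obtain ⟨j, hj⟩ : ∃ j, d a j = x := by
      by_cases hc : x.val ≤ n - m + q
      · refine ⟨⟨q, hqm⟩, Fin.ext ?_⟩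
        simp only [d]
        omega
      · refine ⟨⟨x.val - (n - m), by omega⟩, Fin.ext ?_⟩
        have : s * q ≤ s * (x.val - (n - m)) := Nat.mul_le_mul_left s (by omega)
        change min (t - 1 + s * (x.val - (n - m)) + a.val) (n - m + (x.val - (n - m))) = x.val
        omega
    exact Finset.mem_compl.1 (hx a (Finset.mem_univ a))
      (Finset.mem_image.2 ⟨j, Finset.mem_univ j, hj⟩)
  have hbound := hinter.trans (Finset.card_le_card hsub)
  rw [Fin.card_filter_val_lt] at hbound
  omega
end

section
/- For any ε > 0, any integer s ≥ 2, and any 0 < p < (s−1)/s, there exists a natural number t = t(ε,s,p) such that for every n and every s-wise t-intersecting family 𝓕 of subsets of [n], μ_p(𝓕) < ε. -/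
/-- The `p`-biased weight of a subset `F ⊆ [n]`: `μ_p(F) = p^|F| (1-p)^(n-|F|)`. -/
noncomputable def mu (p : ℝ) (n : ℕ) (F : Finset (Fin n)) : ℝ :=
  p ^ F.card * (1 - p) ^ (n - F.card)

open Finset

/-- The `p`-biased weight of a family of subsets of the finite set `S`. -/
noncomputable def biasedWeight {α : Type*} (p : ℝ) (S : Finset α) (𝓕 : Finset (Finset α)) : ℝ :=
  ∑ F ∈ 𝓕, p ^ #F * (1 - p) ^ (#S - #F)

section BiasedWeight

variable {α : Type*} {p : ℝ} {S : Finset α} {𝓕 𝓖 : Finset (Finset α)}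

lemma biasedWeight_nonneg (hp0 : 0 ≤ p) (hp1 : p ≤ 1) : 0 ≤ biasedWeight p S 𝓕 :=
  sum_nonneg fun _ _ ↦ mul_nonneg (pow_nonneg hp0 _) (pow_nonneg (sub_nonneg.2 hp1) _)

lemma biasedWeight_mono (hp0 : 0 ≤ p) (hp1 : p ≤ 1) (h : 𝓕 ⊆ 𝓖) :
    biasedWeight p S 𝓕 ≤ biasedWeight p S 𝓖 :=
  sum_le_sum_of_subset_of_nonneg h fun _ _ _ ↦
    mul_nonneg (pow_nonneg hp0 _) (pow_nonneg (sub_nonneg.2 hp1) _)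

lemma biasedWeight_powerset : biasedWeight p S S.powerset = 1 := by
  simp [biasedWeight, sum_pow_mul_eq_add_pow]

lemma biasedWeight_le_one (hp0 : 0 ≤ p) (hp1 : p ≤ 1) (h : 𝓕 ⊆ S.powerset) :
    biasedWeight p S 𝓕 ≤ 1 :=
  (biasedWeight_mono hp0 hp1 h).trans_eq biasedWeight_powerset

variable [DecidableEq α] {a : α}

lemma nonMemberSubfamily_subset_powerset (h : 𝓕 ⊆ (insert a S).powerset) :
    𝓕.nonMemberSubfamily a ⊆ S.powerset := fun F hF ↦ by
  rw [mem_nonMemberSubfamily] at hF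
  exact mem_powerset.2 ((subset_insert_iff_of_notMem hF.2).1 (mem_powerset.1 (h hF.1)))

lemma memberSubfamily_subset_powerset (h : 𝓕 ⊆ (insert a S).powerset) :
    𝓕.memberSubfamily a ⊆ S.powerset := fun F hF ↦ by
  rw [mem_memberSubfamily] at hF
  exact mem_powerset.2 <| (subset_insert_iff_of_notMem hF.2).1 <|
    (subset_insert a F).trans (mem_powerset.1 (h hF.1))

lemma biasedWeight_insert (ha : a ∉ S) (h : 𝓕 ⊆ (insert a S).powerset) :
    biasedWeight p (insert a S) 𝓕 = (1 - p) * biasedWeight p S (𝓕.nonMemberSubfamily a) +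
      p * biasedWeight p S (𝓕.memberSubfamily a) := by
  have hinj : Set.InjOn (insert a) (𝓕.memberSubfamily a : Set (Finset α)) := fun A hA B hB hAB ↦ by
    rw [mem_coe, mem_memberSubfamily] at hA hB
    rw [← erase_insert hA.2, ← erase_insert hB.2, hAB]
  have himage : (𝓕.memberSubfamily a).image (insert a) = 𝓕.filter (a ∈ ·) :=
    image_insert_memberSubfamily 𝓕 a
  unfold biasedWeight
  rw [← sum_filter_not_add_sum_filter 𝓕 (a ∈ ·), ← himage, sum_image hinj, mul_sum, mul_sum]
  refine congr_arg₂ (· + ·) (sum_congr rfl fun F hF ↦ ?_) (sum_congr rfl fun F hF ↦ ?_)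
  · have hFS := card_le_card (mem_powerset.1 (nonMemberSubfamily_subset_powerset h hF))
    rw [card_insert_of_notMem ha, Nat.succ_sub hFS, pow_succ]
    ring
  · rw [card_insert_of_notMem ha, card_insert_of_notMem (mem_memberSubfamily.1 hF).2,
      Nat.add_sub_add_right, pow_succ]
    ring

end BiasedWeight

lemma prod_convexCombination_le {ι : Type*} [Fintype ι] [DecidableEq ι] {p β : ℝ} {t : ℕ}
    (hp0 : 0 ≤ p) (hp1 : p ≤ 1) (hβ0 : 0 ≤ β)
    (hβ : ∀ r, β ≤ r → r ≤ 1 → ((1 - p) * r + p) ^ Fintype.card ι ≤ r) {x y : ι → ℝ}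
    (hx : ∀ i, 0 ≤ x i) (hxy : ∀ i, x i ≤ y i) (hy : ∏ i, y i ≤ β ^ t)
    (hupd : ∀ i, ∏ j, Function.update y i (x i) j ≤ β ^ (t + 1)) :
    ∏ i, ((1 - p) * x i + p * y i) ≤ β ^ (t + 1) := by
  have hq : 0 ≤ 1 - p := sub_nonneg.2 hp1
  have hy0 i : 0 ≤ y i := (hx i).trans (hxy i)
  have hterm i : 0 ≤ (1 - p) * x i + p * y i :=
    add_nonneg (mul_nonneg hq (hx i)) (mul_nonneg hp0 (hy0 i))
  rcases le_or_gt (∏ i, y i) (β ^ (t + 1)) with hY | hY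
  · refine (prod_le_prod (fun i _ ↦ hterm i) fun i _ ↦ ?_).trans hY
    nlinarith [mul_le_mul_of_nonneg_left (hxy i) hq]
  have hY0 : 0 < ∏ i, y i := (pow_nonneg hβ0 _).trans_lt hY
  set r := β ^ (t + 1) / ∏ i, y i with hr
  have hrY : r * ∏ i, y i = β ^ (t + 1) := div_mul_cancel₀ _ hY0.ne'
  have hr1 : r ≤ 1 := (div_le_one hY0).2 hY.le
  have hβr : β ≤ r := by
    rw [hr, le_div_iff₀ hY0, pow_succ']
    exact mul_le_mul_of_nonneg_left hy hβ0
  have hxr i : x i ≤ r * y i := by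
    have hrest : 0 < ∏ j ∈ univ \ {i}, y j := by
      refine lt_of_le_of_ne (prod_nonneg fun j _ ↦ hy0 j) fun h ↦ hY0.ne' ?_
      rw [prod_eq_mul_prod_sdiff_singleton_of_mem (mem_univ i), ← h, mul_zero]
    have h := hupd i
    rw [prod_update_of_mem (mem_univ i), ← hrY,
      prod_eq_mul_prod_sdiff_singleton_of_mem (mem_univ i) y, ← mul_assoc] at h
    exact le_of_mul_le_mul_right h hrest
  calc ∏ i, ((1 - p) * x i + p * y i) ≤ ∏ i, ((1 - p) * r + p) * y i :=
        prod_le_prod (fun i _ ↦ hterm i) fun i _ ↦ by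
          nlinarith [mul_le_mul_of_nonneg_left (hxr i) hq]
    _ = ((1 - p) * r + p) ^ Fintype.card ι * ∏ i, y i := by
        rw [prod_mul_distrib, prod_const, card_univ]
    _ ≤ r * ∏ i, y i := mul_le_mul_of_nonneg_right (hβ r hβr hr1) hY0.le
    _ = β ^ (t + 1) := hrY

/-- Cross-`t`-intersecting families indexed by `ι` have a product of biased weights at most `β ^ t`,
whenever `((1 - p) r + p) ^ |ι| ≤ r` on `[β, 1]`. -/
theorem prod_biasedWeight_le_pow {ι α : Type*} [Fintype ι] [DecidableEq ι] [DecidableEq α]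
    {p β : ℝ} (hp0 : 0 ≤ p) (hp1 : p ≤ 1) (hβ0 : 0 ≤ β)
    (hβ : ∀ r, β ≤ r → r ≤ 1 → ((1 - p) * r + p) ^ Fintype.card ι ≤ r) (S : Finset α) :
    ∀ (t : ℕ) (𝓕 : ι → Finset (Finset α)), (∀ i, 𝓕 i ⊆ S.powerset) →
      (∀ G : ι → Finset α, (∀ i, G i ∈ 𝓕 i) → t ≤ #{x ∈ S | ∀ i, x ∈ G i}) →
      ∏ i, biasedWeight p S (𝓕 i) ≤ β ^ t := by
  induction S using Finset.induction_on with
  | empty =>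
    intro t 𝓕 hS h
    by_cases hne : ∀ i, (𝓕 i).Nonempty
    · choose G hG using hne
      obtain rfl : t = 0 := by simpa using h G hG
      rw [pow_zero]
      exact prod_le_one (fun i _ ↦ biasedWeight_nonneg hp0 hp1)
        fun i _ ↦ biasedWeight_le_one hp0 hp1 (hS i)
    · push Not at hne
      obtain ⟨i, hi⟩ := hne
      rw [prod_eq_zero (mem_univ i) (by simp [hi, biasedWeight])]
      exact pow_nonneg hβ0 _
  | insert a S ha ih =>
    intro t 𝓕 hS h
    cases t with
    | zero =>
      rw [pow_zero]
      exact prod_le_one (fun i _ ↦ biasedWeight_nonneg hp0 hp1)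
        fun i _ ↦ biasedWeight_le_one hp0 hp1 (hS i)
    | succ t =>
      set 𝓐 : ι → Finset (Finset α) := fun i ↦ (𝓕 i).nonMemberSubfamily a
      set 𝓤 : ι → Finset (Finset α) :=
        fun i ↦ (𝓕 i).nonMemberSubfamily a ∪ (𝓕 i).memberSubfamily a
      have h𝓐S i : 𝓐 i ⊆ S.powerset := nonMemberSubfamily_subset_powerset (hS i)
      have h𝓤S i : 𝓤 i ⊆ S.powerset :=
        union_subset (h𝓐S i) (memberSubfamily_subset_powerset (hS i))
      have hlift i F (hF : F ∈ 𝓤 i) : ∃ F' ∈ 𝓕 i, F' ⊆ insert a F := by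
        rcases mem_union.1 hF with hF | hF
        · exact ⟨F, (mem_nonMemberSubfamily.1 hF).1, subset_insert a F⟩
        · exact ⟨_, (mem_memberSubfamily.1 hF).1, Subset.rfl⟩
      have hy : ∏ i, biasedWeight p S (𝓤 i) ≤ β ^ t := by
        refine ih t 𝓤 h𝓤S fun G hG ↦ ?_
        choose G' hG' hGG' using fun i ↦ hlift i (G i) (hG i)
        have hsub : {x ∈ insert a S | ∀ i, x ∈ G' i} ⊆ insert a {x ∈ S | ∀ i, x ∈ G i} := by
          intro x hx
          rw [mem_filter] at hx
          by_cases hxa : x = a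
          · exact hxa ▸ mem_insert_self _ _
          · exact mem_insert_of_mem <| mem_filter.2 ⟨mem_of_mem_insert_of_ne hx.1 hxa,
              fun i ↦ mem_of_mem_insert_of_ne (hGG' i (hx.2 i)) hxa⟩
        have := (h G' hG').trans ((card_le_card hsub).trans (card_insert_le _ _))
        omega
      have hupd i : ∏ j, Function.update (fun j ↦ biasedWeight p S (𝓤 j)) i
          (biasedWeight p S (𝓐 i)) j ≤ β ^ (t + 1) := by
        have hsubset j : Function.update 𝓤 i (𝓐 i) j ⊆ 𝓤 j := by
          rcases eq_or_ne j i with rfl | hj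
          · rw [Function.update_self]
            exact subset_union_left
          · rw [Function.update_of_ne hj]
        have hle := ih (t + 1) (Function.update 𝓤 i (𝓐 i))
          (fun j ↦ (hsubset j).trans (h𝓤S j)) fun G hG ↦ by
            have hGi : G i ∈ 𝓐 i := by simpa using hG i
            have hGi' := mem_nonMemberSubfamily.1 hGi
            have hex j : ∃ F' ∈ 𝓕 j, F' ⊆ insert a (G j) ∧ (j = i → F' = G i) := by
              rcases eq_or_ne j i with rfl | hj
              · exact ⟨G j, hGi'.1, subset_insert _ _, fun _ ↦ rfl⟩
              · obtain ⟨F', hF', hF'G⟩ := hlift j (G j) (hsubset j (hG j))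
                exact ⟨F', hF', hF'G, fun h ↦ absurd h hj⟩
            choose G' hG' hGG' hG'i using hex
            refine (h G' hG').trans (card_le_card fun x hx ↦ ?_)
            rw [mem_filter] at hx
            have hxa : x ≠ a := by
              rintro rfl
              exact hGi'.2 (hG'i i rfl ▸ hx.2 i)
            exact mem_filter.2 ⟨mem_of_mem_insert_of_ne hx.1 hxa,
              fun j ↦ mem_of_mem_insert_of_ne (hGG' j (hx.2 j)) hxa⟩
        refine (prod_congr rfl fun j _ ↦ ?_).trans_le hle
        rcases eq_or_ne j i with rfl | hj
        · simp
        · simp [hj]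
      refine le_trans (prod_le_prod (fun i _ ↦ biasedWeight_nonneg hp0 hp1) fun i _ ↦ ?_)
        (prod_convexCombination_le hp0 hp1 hβ0 hβ
          (fun i ↦ biasedWeight_nonneg hp0 hp1)
          (fun i ↦ biasedWeight_mono hp0 hp1 subset_union_left) hy hupd)
      rw [biasedWeight_insert ha (hS i)]
      gcongr
      exact biasedWeight_mono hp0 hp1 subset_union_right

lemma convexCombination_pow_le {p r : ℝ} {s : ℕ} (hp0 : 0 ≤ p) (hp1 : p < 1) (hs : 0 < s)
    (hr0 : 1 / (s * (1 - p)) ≤ r) (hr1 : r ≤ 1) : ((1 - p) * r + p) ^ s ≤ r := by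
  have hq : 0 < 1 - p := sub_pos.2 hp1
  have hsq : 0 < s * (1 - p) := mul_pos (Nat.cast_pos.2 hs) hq
  have hr : 0 < r := (one_div_pos.2 hsq).trans_le hr0
  set x := (1 - p) * (1 - r) with hx
  have hx0 : 0 ≤ x := mul_nonneg hq.le (sub_nonneg.2 hr1)
  have hbern : 1 + s * x ≤ (1 + x) ^ s := one_add_mul_le_pow (by linarith) s
  have hmul : ((1 - p) * r + p) ^ s * (1 + x) ^ s ≤ 1 := by
    rw [← mul_pow]
    refine pow_le_one₀ (by positivity) ?_
    nlinarith [sq_nonneg x]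
  have hone : 1 ≤ r * (1 + s * x) := by
    rw [div_le_iff₀ hsq] at hr0
    nlinarith [mul_nonneg (sub_nonneg.2 hr1) (sub_nonneg.2 hr0)]
  refine le_of_mul_le_mul_right (hmul.trans (hone.trans ?_))
    (pow_pos (by linarith : 0 < 1 + x) s)
  exact mul_le_mul_of_nonneg_left hbern hr.le

/-- For any `ε > 0`, `s ≥ 2`, and `0 < p < (s-1)/s`, there is `t` such that every
`s`-wise `t`-intersecting family of subsets of `[n]` has `μ_p`-weight less than `ε`. -/
theorem intersecting_lemma (ε : ℝ) (hε : 0 < ε) (s : ℕ) (hs : 2 ≤ s) (p : ℝ)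
    (hp0 : 0 < p) (hp1 : p < ((s : ℝ) - 1) / s) :
    ∃ t : ℕ, ∀ (n : ℕ) (𝓕 : Finset (Finset (Fin n))),
      SwiseTIntersecting n s t 𝓕 → ∑ F ∈ 𝓕, mu p n F < ε := by
  have hs0 : 0 < s := by omega
  have hs0' : (0 : ℝ) < s := Nat.cast_pos.2 hs0
  rw [lt_div_iff₀ hs0'] at hp1
  have hplt : p < 1 := by nlinarith
  have hsq : 1 < s * (1 - p) := by linarith
  have hβ0 : 0 ≤ 1 / (s * (1 - p)) := by positivity
  obtain ⟨t, ht⟩ := exists_pow_lt_of_lt_one (pow_pos hε s) ((div_lt_one (by linarith)).2 hsq)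
  refine ⟨t, fun n 𝓕 h𝓕 ↦ lt_of_pow_lt_pow_left₀ s hε.le (lt_of_le_of_lt ?_ ht)⟩
  have hle := prod_biasedWeight_le_pow (ι := Fin s) hp0.le hplt.le hβ0
    (fun r hr hr1 ↦ by
      rw [Fintype.card_fin]
      exact convexCombination_pow_le hp0.le hplt hs0 hr hr1)
    (univ : Finset (Fin n)) t (fun _ ↦ 𝓕) (fun _ F _ ↦ by simp)
    (fun G hG ↦ (h𝓕 G hG).trans_eq (congr_arg card (by ext x; simp [Finset.mem_inf])))
  simpa [biasedWeight, mu] using hle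
end

section
/- Let 0 < δ ≤ 1, let m = ⌈2/δ⌉, and let E₁,…,E_m be events in a probability space with Pr[E_j] ≥ δ for every j. Then there exist indices j < k such that Pr[E_j ∩ E_k] ≥ δ²/4. -/
open MeasureTheory

/-- A Bonferroni inequality: if the pairwise intersections of finitely many sets have measure at
most `c`, the measure of the union falls short of the sum of the measures by at most `c` for each
pair. -/
theorem sum_measureReal_le_biUnion_add_pairs {Ω ι : Type*} [MeasurableSpace Ω]
    (μ : Measure Ω) [IsFiniteMeasure μ] (E : ι → Set Ω) (hmeas : ∀ i, MeasurableSet (E i))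
    (c : ℝ) (hc : ∀ i j, i ≠ j → μ.real (E i ∩ E j) ≤ c) (s : Finset ι) :
    ∑ i ∈ s, μ.real (E i) ≤
      μ.real (⋃ i ∈ s, E i) + c * ((s.card : ℝ) * ((s.card : ℝ) - 1) / 2) := by
  classical
  induction s using Finset.induction_on with
  | empty => simp
  | insert a s ha ih =>
    have hunion := measureReal_union_add_inter (hmeas a)
      (measure_ne_top μ (⋃ i ∈ s, E i)) (measure_ne_top μ (E a))
    have hinter : μ.real ((⋃ i ∈ s, E i) ∩ E a) ≤ s.card * c := by
      rw [Set.iUnion₂_inter]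
      calc μ.real (⋃ i ∈ s, E i ∩ E a) ≤ ∑ i ∈ s, μ.real (E i ∩ E a) :=
            measureReal_biUnion_finset_le s _
        _ ≤ ∑ i ∈ s, c := by
            refine Finset.sum_le_sum fun i hi => hc i a ?_
            rintro rfl
            exact ha hi
        _ = s.card * c := by simp
    rw [Finset.sum_insert ha, Finset.set_biUnion_insert, Set.union_comm,
      Finset.card_insert_of_notMem ha]
    push_cast
    linarith

/-- If `m = ⌈2/δ⌉` events each have probability at least `δ`, then some pair of them
intersects in probability at least `δ²/4`. -/
theorem pairwise_intersection_bound {Ω : Type*} [MeasurableSpace Ω]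
    (μ : Measure Ω) [IsProbabilityMeasure μ]
    (δ : ℝ) (hδ0 : 0 < δ) (hδ1 : δ ≤ 1)
    (m : ℕ) (hm : m = ⌈2 / δ⌉₊)
    (E : Fin m → Set Ω) (hmeas : ∀ j, MeasurableSet (E j))
    (hprob : ∀ j, ENNReal.ofReal δ ≤ μ (E j)) :
    ∃ j k : Fin m, j < k ∧ ENNReal.ofReal (δ ^ 2 / 4) ≤ μ (E j ∩ E k) := by
  by_contra! h
  have hlt : ∀ i j, i < j → μ.real (E i ∩ E j) ≤ δ ^ 2 / 4 := fun i j hij =>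
    ENNReal.toReal_le_of_le_ofReal (by positivity) (h i j hij).le
  have hc : ∀ i j, i ≠ j → μ.real (E i ∩ E j) ≤ δ ^ 2 / 4 := by
    intro i j hij
    rcases lt_or_gt_of_ne hij with hij | hij
    · exact hlt i j hij
    · rw [Set.inter_comm]
      exact hlt j i hij
  have hbonf := sum_measureReal_le_biUnion_add_pairs μ E hmeas _ hc Finset.univ
  have hone : μ.real (⋃ i ∈ (Finset.univ : Finset (Fin m)), E i) ≤ 1 := measureReal_le_one
  have hsum : (m : ℝ) * δ ≤ ∑ i, μ.real (E i) := by
    calc (m : ℝ) * δ = ∑ _i : Fin m, δ := by simp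
      _ ≤ ∑ i, μ.real (E i) := Finset.sum_le_sum fun i _ =>
          (ENNReal.ofReal_le_iff_le_toReal (measure_ne_top _ _)).1 (hprob i)
  rw [Finset.card_univ, Fintype.card_fin] at hbonf
  have hlower : 2 ≤ (m : ℝ) * δ := by
    rw [← div_le_iff₀ hδ0, hm]
    exact Nat.le_ceil _
  have hupper : (m : ℝ) * δ < 2 + δ := by
    have hceil := Nat.ceil_lt_add_one (div_nonneg zero_le_two hδ0.le)
    rw [← hm] at hceil
    calc (m : ℝ) * δ < (2 / δ + 1) * δ := by gcongr
      _ = 2 + δ := by field_simp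
  have hpairs : δ ^ 2 / 4 * ((m : ℝ) * ((m : ℝ) - 1) / 2) =
      (m * δ) * (m * δ - δ) / 8 := by ring
  nlinarith [mul_nonneg (sub_nonneg.2 hlower) (sub_nonneg.2 hupper.le)]
end

section
/- Let 0 < p < 1, let t ≥ 1, and let A₁,…,A_q be pairwise disjoint subsets of [n], each nonempty and of size at most t. Let 𝒢 be a family of subsets of [n] such that every F ∈ 𝒢 intersects every A_i (i = 1,…,q). Then μ_p(𝒢) ≤ (1 − (1−p)^t)^q. -/
/-- The family of all sets avoiding `B` has weight `(1-p)^|B|`. -/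
theorem sum_mu_disjoint (n : ℕ) (p : ℝ) (B : Finset (Fin n)) :
    ∑ F with Disjoint F B, mu p n F = (1 - p) ^ B.card := by
  have hcard : Bᶜ.card + B.card = n := by
    simp [Finset.card_compl_add_card B]
  have hfilter : Finset.univ.filter (fun F : Finset (Fin n) => Disjoint F B) = Bᶜ.powerset := by
    ext F
    simp [Finset.subset_compl_iff_disjoint_right]
  calc ∑ F with Disjoint F B, mu p n F
      = ∑ F ∈ Bᶜ.powerset, p ^ F.card * (1 - p) ^ (Bᶜ.card - F.card) * (1 - p) ^ B.card := by
        rw [hfilter]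
        refine Finset.sum_congr rfl fun F hF => ?_
        have hle := Finset.card_le_card (Finset.mem_powerset.1 hF)
        rw [mu, mul_assoc, ← pow_add]
        congr 2
        omega
    _ = (1 - p) ^ B.card := by
        rw [← Finset.sum_mul, Finset.sum_pow_mul_eq_add_pow]
        simp

/-- For pairwise disjoint `B` and `A i`, avoiding `B` and hitting every `A i` are independent. -/
theorem sum_mu_disjoint_and_hitting {ι : Type*} (n : ℕ) (p : ℝ)
    (A : ι → Finset (Fin n)) (hdisj : ∀ i j, i ≠ j → Disjoint (A i) (A j))
    (I : Finset ι) (B : Finset (Fin n)) (hB : ∀ i ∈ I, Disjoint B (A i)) :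
    ∑ F with Disjoint F B ∧ ∀ i ∈ I, ¬ Disjoint F (A i), mu p n F
      = (1 - p) ^ B.card * ∏ i ∈ I, (1 - (1 - p) ^ (A i).card) := by
  classical
  induction I using Finset.induction_on generalizing B with
  | empty => simpa using sum_mu_disjoint n p B
  | insert a I ha ih =>
    have hBa := hB a (Finset.mem_insert_self a I)
    have hBI : ∀ i ∈ I, Disjoint B (A i) := fun i hi => hB i (Finset.mem_insert_of_mem hi)
    have hunion : ∀ i ∈ I, Disjoint (B ∪ A a) (A i) := fun i hi =>
      Finset.disjoint_union_left.2 ⟨hBI i hi, hdisj a i fun h => ha (h ▸ hi)⟩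
    have hsplit := Finset.sum_filter_add_sum_filter_not
      (Finset.univ.filter fun F => Disjoint F B ∧ ∀ i ∈ I, ¬ Disjoint F (A i))
      (fun F => Disjoint F (A a)) (mu p n)
    have havoid : (Finset.univ.filter fun F => Disjoint F B ∧ ∀ i ∈ I, ¬ Disjoint F (A i)).filter
        (fun F => Disjoint F (A a)) =
        Finset.univ.filter fun F => Disjoint F (B ∪ A a) ∧ ∀ i ∈ I, ¬ Disjoint F (A i) := by
      ext F
      simp only [Finset.mem_filter, Finset.mem_univ, true_and, Finset.disjoint_union_right]
      tauto
    have hhit : (Finset.univ.filter fun F => Disjoint F B ∧ ∀ i ∈ I, ¬ Disjoint F (A i)).filter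
        (fun F => ¬ Disjoint F (A a)) =
        Finset.univ.filter fun F => Disjoint F B ∧ ∀ i ∈ insert a I, ¬ Disjoint F (A i) := by
      ext F
      simp only [Finset.mem_filter, Finset.mem_univ, true_and, Finset.forall_mem_insert]
      tauto
    rw [havoid, hhit, ih B hBI, ih _ hunion, Finset.card_union_of_disjoint hBa, pow_add] at hsplit
    rw [Finset.prod_insert ha]
    linear_combination hsplit

/-- If `A₁,…,A_q` are pairwise disjoint nonempty subsets of `[n]`, each of size at most
`t`, and every member of `𝒢` intersects every `Aᵢ`, then `μ_p(𝒢) ≤ (1-(1-p)^t)^q`. -/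
theorem weight_of_hitting_family (n q t : ℕ) (p : ℝ) (hp0 : 0 < p) (hp1 : p < 1)
    (ht : 1 ≤ t) (A : Fin q → Finset (Fin n))
    (hdisj : ∀ i j, i ≠ j → Disjoint (A i) (A j))
    (hne : ∀ i, (A i).Nonempty)
    (hsize : ∀ i, (A i).card ≤ t)
    (𝒢 : Finset (Finset (Fin n)))
    (hhit : ∀ F ∈ 𝒢, ∀ i, (F ∩ A i).Nonempty) :
    ∑ F ∈ 𝒢, mu p n F ≤ (1 - (1 - p) ^ t) ^ q := by
  have hq0 : 0 ≤ 1 - p := by linarith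
  have hq1 : 1 - p ≤ 1 := by linarith
  calc ∑ F ∈ 𝒢, mu p n F
      ≤ ∑ F with Disjoint F ∅ ∧ ∀ i ∈ Finset.univ, ¬ Disjoint F (A i), mu p n F := by
        refine Finset.sum_le_sum_of_subset_of_nonneg (fun F hF => ?_) fun F _ _ =>
          mul_nonneg (pow_nonneg hp0.le _) (pow_nonneg hq0 _)
        simpa [Finset.not_disjoint_iff_nonempty_inter] using hhit F hF
    _ = ∏ i, (1 - (1 - p) ^ (A i).card) := by
        convert sum_mu_disjoint_and_hitting n p A hdisj Finset.univ ∅ (by simp) using 1 <;> simp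
    _ ≤ ∏ _i : Fin q, (1 - (1 - p) ^ t) :=
        Finset.prod_le_prod (fun i _ => sub_nonneg.2 (pow_le_one₀ hq0 hq1)) fun i _ =>
          sub_le_sub_left (pow_le_pow_of_le_one hq0 hq1 (hsize i)) 1
    _ = (1 - (1 - p) ^ t) ^ q := by simp
end
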